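/- arXiv:2506.21493 — 4 statements merged into one kernel-verified Lean document; each statement's English description precedes it below -/
import Mathlib

section
/- In every multi-graph allocation instance on n agents with a finite item set M in which every agent i has a normalized, monotone, subadditive valuation v_i on M satisfying v_i(S) = v_i(S ∩ M^i) for all S ⊆ M, if δ_i = max_{e ∈ M^i} v_i({e}) (with δ_i = 0 when M^i is empty), then there exists an orientation allocation in which every agent i receives a bundle A_i with v_i(A_i) ≥ (v_i(M) − δ_i)/2. -/
open Finset

/-- A valuation on `M`: normalized, monotone, and subadditive. -/
def IsValuation {α : Type*} [DecidableEq α] (M : Finset α) (v : Finset α → ℝ) : Prop :=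
  v ∅ = 0 ∧ (∀ S T : Finset α, S ⊆ T → T ⊆ M → v S ≤ v T) ∧
    ∀ S T : Finset α, S ⊆ M → T ⊆ M → v (S ∪ T) ≤ v S + v T

/-- `max_{e ∈ A} v {e}`, with value `0` if `A` is empty. -/
noncomputable def maxSingle {α : Type*} [DecidableEq α] (v : Finset α → ℝ) (A : Finset α) : ℝ :=
  if h : A.Nonempty then A.sup' h (fun e => v {e}) else 0

section Orientation

variable {α ι : Type*} [DecidableEq ι]

/-- The items incident to `i` that the orientation `f` gives to `i`. -/
def heldItems (M : Finset α) (E : α → Finset ι) (f : α → ι) (i : ι) : Finset α :=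
  M.filter fun e => i ∈ E e ∧ f e = i

/-- The items incident to `i` that the orientation `f` does not give to `i`. -/
def lostItems (M : Finset α) (E : α → Finset ι) (f : α → ι) (i : ι) : Finset α :=
  M.filter fun e => i ∈ E e ∧ f e ≠ i

/-- `f` orients the items meeting `C` towards `C`, and every agent of `C` is satisfied. -/
def IsGoodOrientation (M : Finset α) (E : α → Finset ι) (Good : ι → Finset α → Prop)
    (C : Finset ι) (f : α → ι) : Prop :=
  (∀ e ∈ M, (E e ∩ C).Nonempty → f e ∈ E e ∩ C) ∧ ∀ i ∈ C, Good i (heldItems M E f i)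

/-- An orientation `f` together with agent prices `p`: an item never goes to an agent whose price
is lower by more than one, and agents with a positive price would accept what they lost. -/
structure IsPriced (M : Finset α) (E : α → Finset ι) (Good : ι → Finset α → Prop)
    (C : Finset ι) (p : ι → ℕ) (f : α → ι) : Prop where
  owner : ∀ e ∈ M, (E e ∩ C).Nonempty → f e ∈ E e ∩ C
  le_card : ∀ i, p i ≤ C.card
  le_owner : ∀ e ∈ M, ∀ i ∈ E e ∩ C, p i ≤ p (f e) + 1
  lost : ∀ i ∈ C, 0 < p i → Good i (lostItems M E f i)

variable {M : Finset α} {E : α → Finset ι} {Good : ι → Finset α → Prop} {C : Finset ι}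
  {p : ι → ℕ} {f : α → ι}

/-- As long as an unsatisfied agent has not reached the maximal price, it can take an item from a
cheaper agent or raise its price. -/
lemma IsPriced.exists_lt (h : IsPriced M E Good C p f)
    (mono : ∀ i S T, S ⊆ T → T ⊆ M → Good i S → Good i T)
    (cover : ∀ i, ∀ S ⊆ M, ∀ T ⊆ M, ∀ D : Finset α, D.card ≤ 1 →
      (∀ e ∈ M, i ∈ E e → e ∈ S ∨ e ∈ T ∨ e ∈ D) → Good i S ∨ Good i T)
    {i : ι} (hi : i ∈ C) (hbad : ¬ Good i (heldItems M E f i)) (hp : p i < C.card) :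
    ∃ p' f', IsPriced M E Good C p' f' ∧
      ∑ j ∈ C, p j + ∑ e ∈ M, p (f e) < ∑ j ∈ C, p' j + ∑ e ∈ M, p' (f' e) := by
  classical
  by_cases hx : ∃ x ∈ M, i ∈ E x ∧ f x ≠ i ∧ p (f x) < p i
  · obtain ⟨x, hxM, hix, hfx, hlt⟩ := hx
    refine ⟨p, Function.update f x i, ⟨?_, h.le_card, ?_, ?_⟩, ?_⟩
    · intro e he hne
      by_cases hex : e = x
      · subst hex; simp [hix, hi]
      · simpa [hex] using h.owner e he hne
    · intro e he j hj
      have := h.le_owner e he j hj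
      by_cases hex : e = x
      · subst hex; simp only [Function.update_self]; omega
      · simpa [hex] using this
    · intro j hj hpj
      by_cases hji : j = i
      · subst hji
        refine (cover j _ (filter_subset _ _) _ (filter_subset _ _) {x} (by simp) ?_).resolve_left
          hbad
        intro e he hje
        by_cases hex : e = x
        · simp [hex]
        · by_cases hfe : f e = j <;> simp [heldItems, lostItems, he, hje, hex, hfe]
      · refine mono j _ _ ?_ (filter_subset _ _) (h.lost j hj hpj)
        intro e he
        simp only [lostItems, mem_filter] at he ⊢
        refine ⟨he.1, he.2.1, ?_⟩
        by_cases hex : e = x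
        · subst hex; simpa using Ne.symm hji
        · simpa [hex] using he.2.2
    · refine Nat.add_lt_add_left (sum_lt_sum ?_ ⟨x, hxM, by simpa using hlt⟩) _
      intro e _
      by_cases hex : e = x
      · subst hex; simpa using hlt.le
      · simp [hex]
  · push Not at hx
    have hle : ∀ j, p j ≤ Function.update p i (p i + 1) j := by
      intro j
      by_cases hji : j = i
      · subst hji; simp
      · simp [hji]
    refine ⟨Function.update p i (p i + 1), f, ⟨h.owner, ?_, ?_, ?_⟩, ?_⟩
    · intro j
      by_cases hji : j = i
      · subst hji; simpa using hp
      · simpa [hji] using h.le_card j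
    · intro e he j hj
      by_cases hji : j = i
      · subst hji
        by_cases hfe : f e = j
        · simp [hfe]
        · have := hx e he (mem_inter.1 hj).1 hfe
          simpa [hfe] using this
      · have h1 := h.le_owner e he j hj
        have h2 := hle (f e)
        rw [Function.update_of_ne hji]
        omega
    · intro j hj hpj
      by_cases hji : j = i
      · subst hji
        refine (cover j _ (filter_subset _ _) _ (filter_subset _ _) ∅ (by simp) ?_).resolve_left
          hbad
        intro e he hje
        by_cases hfe : f e = j <;> simp [heldItems, lostItems, he, hje, hfe]
      · exact h.lost j hj (by simpa [hji] using hpj)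
    · exact Nat.add_lt_add_of_lt_of_le (sum_lt_sum (fun j _ => hle j) ⟨i, hi, by simp⟩)
        (sum_le_sum fun e _ => hle _)

/-- There is a priced orientation in which every unsatisfied agent has the maximal price. -/
lemma exists_isPriced_card_le [Nonempty ι]
    (mono : ∀ i S T, S ⊆ T → T ⊆ M → Good i S → Good i T)
    (cover : ∀ i, ∀ S ⊆ M, ∀ T ⊆ M, ∀ D : Finset α, D.card ≤ 1 →
      (∀ e ∈ M, i ∈ E e → e ∈ S ∨ e ∈ T ∨ e ∈ D) → Good i S ∨ Good i T) :
    ∃ p f, IsPriced M E Good C p f ∧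
      ∀ i ∈ C, ¬ Good i (heldItems M E f i) → C.card ≤ p i := by
  by_contra! hno
  have hgrow : ∀ k : ℕ, ∃ p f, IsPriced M E Good C p f ∧
      k ≤ ∑ j ∈ C, p j + ∑ e ∈ M, p (f e) := by
    intro k
    induction k with
    | zero =>
      classical
      refine ⟨fun _ => 0, fun e => if h : (E e ∩ C).Nonempty then h.choose else
        Classical.arbitrary ι, ⟨?_, by simp, by simp, by simp⟩, by simp⟩
      intro e _ hne
      simp only [hne, dif_pos]
      exact hne.choose_spec
    | succ k ih =>
      obtain ⟨p, f, h, hk⟩ := ih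
      obtain ⟨i, hi, hbad, hp⟩ := hno p f h
      obtain ⟨p', f', h', hlt⟩ := h.exists_lt mono cover hi hbad hp
      exact ⟨p', f', h', by omega⟩
  obtain ⟨p, f, h, hk⟩ := hgrow (C.card * C.card + M.card * C.card + 1)
  have h1 : ∑ j ∈ C, p j ≤ C.card * C.card := by
    simpa using sum_le_card_nsmul C p C.card fun j _ => h.le_card j
  have h2 : ∑ e ∈ M, p (f e) ≤ M.card * C.card := by
    simpa using sum_le_card_nsmul M (fun e => p (f e)) C.card fun e _ => h.le_card _
  omega

/-- If all prices are positive, the reversed orientation satisfies everyone. -/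
lemma IsPriced.exists_isGoodOrientation_of_pos (h : IsPriced M E Good C p f)
    (hE : ∀ e ∈ M, (E e).card ≤ 2)
    (mono : ∀ i S T, S ⊆ T → T ⊆ M → Good i S → Good i T) (hpos : ∀ i ∈ C, 0 < p i) :
    ∃ g, IsGoodOrientation M E Good C g := by
  classical
  refine ⟨fun e => if hj : ∃ j ∈ E e ∩ C, j ≠ f e then hj.choose else f e, ?_, ?_⟩
  · intro e he hne
    by_cases hj : ∃ j ∈ E e ∩ C, j ≠ f e
    · simp only [hj, dif_pos]
      exact hj.choose_spec.1
    · simp only [hj, dif_neg, not_false_eq_true]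
      exact h.owner e he hne
  · intro i hi
    refine mono i _ _ ?_ (filter_subset _ _) (h.lost i hi (hpos i hi))
    intro e he
    simp only [lostItems, heldItems, mem_filter] at he ⊢
    obtain ⟨heM, hie, hfe⟩ := he
    refine ⟨heM, hie, ?_⟩
    have hj : ∃ j ∈ E e ∩ C, j ≠ f e := ⟨i, by simp [hie, hi], Ne.symm hfe⟩
    simp only [hj, dif_pos]
    obtain ⟨hmem, hne⟩ := hj.choose_spec
    by_contra hji
    have hown := h.owner e heM ⟨i, by simp [hie, hi]⟩
    have hcard : ({hj.choose, f e, i} : Finset ι).card = 3 :=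
      card_eq_three.2 ⟨_, _, _, hne, hji, hfe, rfl⟩
    have hsub : ({hj.choose, f e, i} : Finset ι) ⊆ E e := by
      intro k hk
      simp only [mem_insert, mem_singleton] at hk
      rcases hk with rfl | rfl | rfl
      · exact (mem_inter.1 hmem).1
      · exact (mem_inter.1 hown).1
      · exact hie
    have := card_le_card hsub
    have := hE e heM
    omega

/-- Suppose that for each agent, one of any two sets covering all but at most one of its incident
items is satisfactory. Then some orientation satisfies all agents. -/
theorem exists_isGoodOrientation [Nonempty ι] (hE : ∀ e ∈ M, (E e).card ≤ 2)
    (mono : ∀ i S T, S ⊆ T → T ⊆ M → Good i S → Good i T)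
    (cover : ∀ i, ∀ S ⊆ M, ∀ T ⊆ M, ∀ D : Finset α, D.card ≤ 1 →
      (∀ e ∈ M, i ∈ E e → e ∈ S ∨ e ∈ T ∨ e ∈ D) → Good i S ∨ Good i T) (C : Finset ι) :
    ∃ f, IsGoodOrientation M E Good C f := by
  induction C using Finset.strongInduction with
  | H C ih =>
  obtain ⟨p, f, h, hmax⟩ := exists_isPriced_card_le (C := C) mono cover
  by_cases hpos : ∀ i ∈ C, 0 < p i
  · exact h.exists_isGoodOrientation_of_pos hE mono hpos
  by_cases hbad : ∀ i ∈ C, Good i (heldItems M E f i)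
  · exact ⟨f, h.owner, hbad⟩
  push Not at hpos hbad
  obtain ⟨k, hk, hk0⟩ := hpos
  obtain ⟨b, hb, hbbad⟩ := hbad
  have hpb := hmax b hb hbbad
  obtain ⟨t, ht, htp⟩ : ∃ t ∈ range (C.card + 1), t ∉ C.image p := by
    by_contra! hall
    have h1 := card_le_card (show range (C.card + 1) ⊆ C.image p from hall)
    have h2 : (C.image p).card ≤ C.card := card_image_le
    simp at h1
    omega
  have hlevel : ∀ i ∈ C, p i ≠ t := fun i hi hpt => htp (mem_image.2 ⟨i, hi, hpt⟩)
  have htC : t ≤ C.card := by simpa [Nat.lt_succ_iff] using ht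
  have hkt : p k < t := by have := hlevel k hk; omega
  -- The agents above the empty price level `t` do without the items held below it.
  obtain ⟨g, hgown, hggood⟩ := ih (C.filter fun i => t < p i)
    (filter_ssubset.2 ⟨k, hk, by omega⟩)
  refine ⟨fun e => if (E e ∩ C.filter fun i => t < p i).Nonempty then g e else f e, ?_, ?_⟩
  · intro e he hne
    by_cases hU : (E e ∩ C.filter fun i => t < p i).Nonempty
    · simp only [hU, if_true]
      exact inter_subset_inter_left (filter_subset _ _) (hgown e he hU)
    · simp only [hU, if_false]
      exact h.owner e he hne
  · intro i hi
    by_cases hit : t < p i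
    · have hiU : i ∈ C.filter fun i => t < p i := mem_filter.2 ⟨hi, hit⟩
      refine mono i _ _ ?_ (filter_subset _ _) (hggood i hiU)
      intro e he
      simp only [heldItems, mem_filter] at he ⊢
      have hU : (E e ∩ C.filter fun i => t < p i).Nonempty := ⟨i, mem_inter.2 ⟨he.2.1, hiU⟩⟩
      simp only [hU, if_true]
      exact he
    · have hpi := hlevel i hi
      have hgood : Good i (heldItems M E f i) := by
        by_contra hib
        have := hmax i hi hib
        omega
      refine mono i _ _ ?_ (filter_subset _ _) hgood
      intro e he
      simp only [heldItems, mem_filter] at he ⊢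
      have hU : ¬ (E e ∩ C.filter fun i => t < p i).Nonempty := by
        rintro ⟨u, hu⟩
        simp only [mem_inter, mem_filter] at hu
        have := h.le_owner e he.1 u (mem_inter.2 ⟨hu.1, hu.2.1⟩)
        rw [he.2.2] at this
        omega
      simp only [hU, if_false]
      exact he

end Orientation

section Valuation

variable {α : Type*} [DecidableEq α] {M A S T D : Finset α} {v : Finset α → ℝ}

lemma IsValuation.nonneg (hv : IsValuation M v) (hS : S ⊆ M) : 0 ≤ v S :=
  hv.1 ▸ hv.2.1 ∅ S (empty_subset S) hS

lemma IsValuation.le_maxSingle (hv : IsValuation M v) (hA : A ⊆ M) (hD : D ⊆ A)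
    (hcard : D.card ≤ 1) : v D ≤ maxSingle v A := by
  have hsingle : ∀ x ∈ A, v {x} ≤ maxSingle v A := by
    intro x hx
    rw [maxSingle, dif_pos ⟨x, hx⟩]
    exact le_sup' (fun e => v {e}) hx
  rcases Nat.le_one_iff_eq_zero_or_eq_one.1 hcard with h0 | h1
  · rw [card_eq_zero.1 h0, hv.1]
    rcases A.eq_empty_or_nonempty with rfl | ⟨x, hx⟩
    · simp [maxSingle]
    · exact (hv.nonneg (singleton_subset_iff.2 (hA hx))).trans (hsingle x hx)
  · obtain ⟨x, rfl⟩ := card_eq_one.1 h1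
    exact hsingle x (singleton_subset_iff.1 hD)

lemma IsValuation.half_le_or_half_le (hv : IsValuation M v) (hA : A ⊆ M) (hvA : v M = v A)
    (hS : S ⊆ M) (hT : T ⊆ M) (hcard : D.card ≤ 1)
    (hcover : ∀ e ∈ A, e ∈ S ∨ e ∈ T ∨ e ∈ D) :
    (v M - maxSingle v A) / 2 ≤ v S ∨ (v M - maxSingle v A) / 2 ≤ v T := by
  have hDA : A ∩ D ⊆ M := inter_subset_left.trans hA
  have hD : v (A ∩ D) ≤ maxSingle v A :=
    hv.le_maxSingle hA inter_subset_left ((card_le_card inter_subset_right).trans hcard)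
  have hsub : A ⊆ S ∪ T ∪ A ∩ D := by
    intro e he
    have := hcover e he
    simp only [mem_union, mem_inter]
    tauto
  have h1 := hv.2.1 _ _ hsub (union_subset (union_subset hS hT) hDA)
  have h2 := hv.2.2 _ _ (union_subset hS hT) hDA
  have h3 := hv.2.2 _ _ hS hT
  by_contra! hlt
  linarith [hlt.1, hlt.2]

end Valuation

theorem stmt13 {α : Type*} [DecidableEq α] (n : ℕ) (hn : 0 < n)
    (M : Finset α) (E : α → Finset (Fin n)) (hE : ∀ e ∈ M, (E e).card ≤ 2)
    (v : Fin n → Finset α → ℝ) (hv : ∀ i, IsValuation M (v i))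
    (hloc : ∀ i, ∀ S ⊆ M, v i S = v i (S.filter fun e => i ∈ E e)) :
    ∃ f : α → Fin n,
      (∀ e ∈ M, (E e).Nonempty → f e ∈ E e) ∧
      ∀ i, v i (M.filter fun e => f e = i) ≥
        (v i M - maxSingle (v i) (M.filter fun e => i ∈ E e)) / 2 := by
  have : Nonempty (Fin n) := ⟨⟨0, hn⟩⟩
  obtain ⟨f, hown, hgood⟩ := exists_isGoodOrientation (M := M) (E := E)
    (Good := fun i S => (v i M - maxSingle (v i) (M.filter fun e => i ∈ E e)) / 2 ≤ v i S) hE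
    (fun i S T hST hT hS => hS.trans ((hv i).2.1 S T hST hT))
    (fun i S hS T hT D hD hcover =>
      (hv i).half_le_or_half_le (filter_subset _ _) (hloc i M Subset.rfl) hS hT hD
        fun e he => hcover e (mem_filter.1 he).1 (mem_filter.1 he).2)
    univ
  refine ⟨f, fun e he hne => by simpa using hown e he (by simpa using hne), fun i => ?_⟩
  refine (hgood i (mem_univ i)).trans ((hv i).2.1 _ _ ?_ (filter_subset _ _))
  intro e he
  simp only [heldItems, mem_filter] at he ⊢
  exact ⟨he.1, he.2.2⟩
end

section
/- Let (d_1, …, d_n) be a tuple of positive integers, each a power of 2, let M be a finite set of items, and let (A_1, …, A_n) be a (d_1, …, d_n)-multi-allocation of M, meaning that for every agent i, every item belonging to A_i belongs to at most d_i of the sets A_1, …, A_n. Suppose every agent i has a normalized, monotone, subadditive valuation v_i on M, and let δ_i = max_{e ∈ A_i} v_i({e}) (with δ_i = 0 if A_i is empty). Then there exists an allocation (A'_1, …, A'_n) with A'_i ⊆ A_i for every i such that v_i(A'_i) ≥ v_i(A_i)/d_i − ((d_i−1)/d_i)·δ_i for every agent i. -/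
open Finset

/-- A finite set of agents can be matched up, leaving at most one of them alone, so that a subset
without matched agents contains at most half of them, rounded up. -/
lemma exists_pairing {ι : Type*} [DecidableEq ι] (F : Finset ι) :
    ∃ c : ι → ι, Function.Involutive c ∧ (∀ i, i ∉ F → c i = i) ∧
      ∀ G ⊆ F, (∀ i ∈ G, c i ≠ i → c i ∉ G) → 2 * #G ≤ #F + 1 := by
  induction F using Finset.strongInduction with
  | H F ih =>
  rcases Nat.lt_or_ge 1 #F with hF | hF
  · obtain ⟨a, ha, b, hb, hab⟩ := Finset.one_lt_card.1 hF
    obtain ⟨c, hc, hfix, hcard⟩ := ih ((F.erase a).erase b)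
      ((Finset.erase_subset _ _).trans_ssubset (Finset.erase_ssubset ha))
    have hca : c a = a := hfix a (by simp)
    have hcb : c b = b := hfix b (by simp)
    have hne (i j : ι) (hj : c j = j) (hi : i ≠ j) : c i ≠ j := fun h => hi (by
      rw [← hc i, h, hj])
    refine ⟨fun i => if i = a then b else if i = b then a else c i, ?_, ?_, ?_⟩
    · intro i
      by_cases hia : i = a
      · simp [hia, hab.symm]
      · by_cases hib : i = b
        · simp [hib, hab.symm]
        · simp [hia, hib, hne i a hca hia, hne i b hcb hib, hc i]
    · intro i hi
      have hia : i ≠ a := fun h => hi (h ▸ ha)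
      have hib : i ≠ b := fun h => hi (h ▸ hb)
      simp only [hia, hib, if_false]
      exact hfix i (by simp [hi])
    · intro G hG hind
      have hrest := hcard ((G.erase a).erase b)
        (Finset.erase_subset_erase _ (Finset.erase_subset_erase _ hG)) (by
          intro i hi hci hmem
          simp only [Finset.mem_erase] at hi hmem
          have := hind i hi.2.2
          simp only [hi.1, hi.2.1, if_false] at this
          exact this hci hmem.2.2)
      have hF2 : #((F.erase a).erase b) + 2 = #F := by
        have hba : b ∈ F.erase a := Finset.mem_erase.2 ⟨hab.symm, hb⟩
        have h1 := Finset.card_erase_add_one hba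
        have h2 := Finset.card_erase_add_one ha
        omega
      have hG1 : #G ≤ #((G.erase a).erase b) + 1 := by
        by_cases haG : a ∈ G
        · have hbG : b ∉ G := by
            have := hind a haG
            simp only [if_true] at this
            exact this hab.symm
          have h2 := Finset.card_erase_add_one haG
          rw [Finset.erase_eq_of_notMem (a := b) (by simp [hbG])]
          omega
        · rw [Finset.erase_eq_of_notMem haG]
          have := Finset.pred_card_le_card_erase (s := G) (a := b)
          omega
      omega
  · refine ⟨id, fun _ => rfl, fun _ _ => rfl, fun G hG _ => ?_⟩
    have := Finset.card_le_card hG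
    omega

lemma exists_injOn_lt_card {α : Type*} [DecidableEq α] (M : Finset α) :
    ∃ f : α → ℕ, Set.InjOn f M ∧ ∀ e ∈ M, f e < #M := by
  refine ⟨fun e => M.toList.idxOf e, ?_, ?_⟩
  · intro a ha b _ h
    exact (List.idxOf_inj (Finset.mem_toList.2 ha)).1 h
  · intro e he
    rw [← Finset.length_toList]
    exact List.idxOf_lt_length_iff.2 (Finset.mem_toList.2 he)

/-- Agent `i` with price `p i` outbids its competitor `c e i ∈ U` for the item `e`. Increasing
`p i` by one raises the bid `(p i + f e) / m` on one residue class of `f e` modulo `m` only. -/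
def Outbids {α ι : Type*} [LT ι] (U : Finset ι) (c : α → ι → ι) (f : α → ℕ) (m : ℕ)
    (p : ι → ℕ) (i : ι) (e : α) : Prop :=
  c e i ∈ U → c e i ≠ i → (p (c e i) + f e) / m < (p i + f e) / m ∨
    ((p (c e i) + f e) / m = (p i + f e) / m ∧ i < c e i)

section Auction

variable {α ι : Type*} [LinearOrder ι] {U : Finset ι} {c : α → ι → ι} {f : α → ℕ} {m : ℕ}
  {p : ι → ℕ} {i j : ι} {e : α}

lemma Outbids.not_competitor (hc : ∀ e, Function.Involutive (c e)) (hi : i ∈ U)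
    (hU : c e i ∈ U) (hne : c e i ≠ i) (h : Outbids U c f m p i e) :
    ¬ Outbids U c f m p (c e i) e := by
  intro h'
  have h1 := h hU hne
  have h2 := h' (by rwa [hc e i]) (by rw [hc e i]; exact hne.symm)
  rw [hc e i] at h2
  rcases h1 with h1 | ⟨h1, h1'⟩ <;> rcases h2 with h2 | ⟨h2, h2'⟩
  · omega
  · omega
  · omega
  · exact lt_asymm h1' h2'

lemma Outbids.competitor_of_not (hc : ∀ e, Function.Involutive (c e))
    (h : ¬ Outbids U c f m p i e) : Outbids U c f m p (c e i) e := by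
  unfold Outbids at h ⊢
  rw [hc e i]
  push Not at h
  obtain ⟨-, hne, h1, h2⟩ := h
  intro _ _
  rcases h1.lt_or_eq with h1 | h1
  · exact Or.inl h1
  · exact Or.inr ⟨h1, (h2 h1.symm).lt_of_ne hne⟩

lemma Outbids.of_update_self
    (h : Outbids U c f m (Function.update p i (p i + 1)) i e) (hm : ¬ m ∣ p i + f e + 1) :
    Outbids U c f m p i e := by
  intro hU hne
  have := h hU hne
  rwa [Function.update_self, Function.update_of_ne hne,
    show p i + 1 + f e = p i + f e + 1 by ring, Nat.succ_div, if_neg hm, add_zero] at this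

lemma Outbids.of_update_of_ne (hij : j ≠ i)
    (h : Outbids U c f m (Function.update p i (p i + 1)) j e) : Outbids U c f m p j e := by
  intro hU hne
  have := h hU hne
  rw [Function.update_of_ne hij] at this
  by_cases hci : c e j = i
  · rw [hci, Function.update_self] at this
    rw [hci]
    have hle : (p i + f e) / m ≤ (p i + 1 + f e) / m := Nat.div_le_div_right (by omega)
    rcases this with h1 | ⟨h1, h2⟩
    · exact Or.inl (hle.trans_lt h1)
    · rcases (hle.trans_eq h1).lt_or_eq with h3 | h3
      · exact Or.inl h3
      · exact Or.inr ⟨h3, h2⟩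
  · rwa [Function.update_of_ne hci] at this

lemma outbids_of_add_le (hm : 0 < m) (h : p (c e i) + m ≤ p i) : Outbids U c f m p i e := by
  intro _ _
  left
  have h1 : (p (c e i) + f e) / m + 1 = (p (c e i) + f e + m) / m := by
    rw [Nat.add_div_right _ hm]
  have h2 : (p (c e i) + f e + m) / m ≤ (p i + f e) / m := Nat.div_le_div_right (by omega)
  omega

end Auction

open Classical in
/-- If every agent accepts one side of each partition of its items into two parts and at most one
discarded item, then items contested by pairs of agents can be distributed acceptably. -/
lemma exists_acceptable_of_pairing {α ι : Type*} [DecidableEq α] [LinearOrder ι]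
    (M : Finset α) (A : ι → Finset α) (hAM : ∀ i, A i ⊆ M) (c : α → ι → ι)
    (hc : ∀ e, Function.Involutive (c e)) (good : ι → Finset α → Prop)
    (hmono : ∀ i S T, S ⊆ T → T ⊆ A i → good i S → good i T)
    (hsplit : ∀ i S R, S ⊆ A i → #R ≤ 1 → good i (S \ R) ∨ good i (A i \ S)) (U : Finset ι) :
    ∃ B : ι → Finset α, (∀ i ∈ U, B i ⊆ A i ∧ good i (B i)) ∧
      ∀ i ∈ U, ∀ e ∈ B i, c e i ∈ U → c e i ≠ i → e ∉ B (c e i) := by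
  induction U using Finset.strongInduction with
  | H U ih =>
  obtain ⟨f, hf, hflt⟩ := exists_injOn_lt_card M
  set m := #M + 1 with hm
  let won (p : ι → ℕ) (i : ι) : Finset α := (A i).filter (Outbids U c f m p i)
  have won_sub (p i) : won p i ⊆ A i := Finset.filter_subset _ _
  let Inv (p : ι → ℕ) : Prop :=
    ∀ i ∈ U, p i = 0 ∨ ∃ R : Finset α, #R ≤ 1 ∧ ¬ good i (won p i \ R)
  by_cases hgood : ∃ p, Inv p ∧ ∀ i ∈ U, good i (won p i)
  · obtain ⟨p, -, hp⟩ := hgood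
    refine ⟨won p, fun i hi => ⟨won_sub p i, hp i hi⟩, fun i hi e he hU hne hmem => ?_⟩
    exact (Finset.mem_filter.1 he).2.not_competitor hc hi hU hne (Finset.mem_filter.1 hmem).2
  push Not at hgood
  have hlarge : ∀ N : ℕ, ∃ p, Inv p ∧ N ≤ ∑ i ∈ U, p i := by
    intro N
    induction N with
    | zero => exact ⟨fun _ => 0, fun _ _ => Or.inl rfl, Nat.zero_le _⟩
    | succ N ihN =>
      obtain ⟨p, hp, hN⟩ := ihN
      obtain ⟨i, hi, hbad⟩ := hgood p hp
      refine ⟨Function.update p i (p i + 1), fun j hj => ?_, ?_⟩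
      · by_cases hji : j = i
        · subst hji
          refine Or.inr ⟨M.filter fun e => m ∣ p j + f e + 1, ?_, fun h => hbad ?_⟩
          · refine Finset.card_le_one.2 fun a ha b hb => ?_
            rw [Finset.mem_filter] at ha hb
            have hmod : (p j + 1) + f a ≡ (p j + 1) + f b [MOD m] := by
              have h1 := (Nat.modEq_zero_iff_dvd.2 ha.2).trans
                (Nat.modEq_zero_iff_dvd.2 hb.2).symm
              convert h1 using 1 <;> ring
            have h2 := Nat.ModEq.add_left_cancel' _ hmod
            exact hf ha.1 hb.1 (h2.eq_of_lt_of_lt ((hflt a ha.1).trans (by omega))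
              ((hflt b hb.1).trans (by omega)))
          · refine hmono j _ _ (fun e he => ?_) (won_sub p j) h
            simp only [Finset.mem_sdiff, Finset.mem_filter, won, not_and] at he ⊢
            exact ⟨he.1.1, he.1.2.of_update_self (he.2 (hAM j he.1.1))⟩
        · rcases hp j hj with h0 | ⟨R, hR, hRbad⟩
          · exact Or.inl (by rwa [Function.update_of_ne hji])
          · refine Or.inr ⟨R, hR, fun h => hRbad (hmono j _ _ ?_
              (Finset.sdiff_subset.trans (won_sub p j)) h)⟩
            refine Finset.sdiff_subset_sdiff (fun e he => ?_) le_rfl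
            rw [Finset.mem_filter] at he ⊢
            exact ⟨he.1, he.2.of_update_of_ne hji⟩
      · rw [← Finset.add_sum_erase U p hi, Finset.erase_eq] at hN
        rw [Finset.sum_update_of_mem hi]
        omega
  obtain ⟨p, hp, hN⟩ := hlarge (∑ _i ∈ U, m * #U + 1)
  obtain ⟨a, haU, ha⟩ := Finset.exists_lt_of_sum_lt (Nat.lt_of_succ_le hN)
  have hdiv : #U ≤ p a / m := (Nat.le_div_iff_mul_le (by omega)).2 (by
    rw [mul_comm]; exact ha.le)
  obtain ⟨s, hs, hgap⟩ : ∃ s < #U, ∀ i ∈ U, p i / m ≠ s := by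
    by_contra! hcon
    have hsub : insert (p a / m) (Finset.range #U) ⊆ U.image fun i => p i / m := by
      intro x hx
      rcases Finset.mem_insert.1 hx with rfl | hx
      · exact Finset.mem_image_of_mem (fun i => p i / m) haU
      · obtain ⟨i, hi, rfl⟩ := hcon x (Finset.mem_range.1 hx)
        exact Finset.mem_image_of_mem (fun i => p i / m) hi
    have h1 := (Finset.card_le_card hsub).trans Finset.card_image_le
    rw [Finset.card_insert_of_notMem (by simpa using hdiv), Finset.card_range] at h1
    omega
  let K := U.filter fun i => s < p i / m
  have haK : a ∈ K := Finset.mem_filter.2 ⟨haU, by omega⟩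
  obtain ⟨B, hB, hBdisj⟩ := ih (U \ K)
    (Finset.sdiff_ssubset (Finset.filter_subset _ _) ⟨a, haK⟩)
  have hlost {i e} (hi : i ∈ K) (he : e ∈ A i \ won p i) :
      c e i ∈ K ∧ (e ∉ A (c e i) \ won p (c e i)) := by
    simp only [Finset.mem_sdiff, Finset.mem_filter, won, not_and] at he
    have hnot := he.2 he.1
    refine ⟨?_, fun h => ?_⟩
    · have hU : c e i ∈ U := by
        by_contra hU
        exact hnot fun h => absurd h hU
      refine Finset.mem_filter.2 ⟨hU, ?_⟩
      by_contra hlt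
      have hlt' : p (c e i) / m + 1 ≤ s := by
        have := hgap _ hU
        omega
      have hi2 := (Finset.mem_filter.1 hi).2
      refine hnot (outbids_of_add_le (by omega) ?_)
      have h1 : p (c e i) < m * s := by
        rw [mul_comm]
        exact (Nat.div_lt_iff_lt_mul (by omega)).1 hlt'
      have h2 : m * (s + 1) ≤ p i := by
        rw [mul_comm]
        exact (Nat.le_div_iff_mul_le (by omega)).1 hi2
      rw [mul_add] at h2
      omega
    · simp only [Finset.mem_sdiff, Finset.mem_filter, won, not_and] at h
      exact h.2 h.1 (Outbids.competitor_of_not hc hnot)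
  refine ⟨fun i => if i ∈ K then A i \ won p i else B i, fun i hi => ?_, ?_⟩
  · by_cases hiK : i ∈ K
    · simp only [if_pos hiK]
      refine ⟨Finset.sdiff_subset, ?_⟩
      rcases hp i hi with h0 | ⟨R, hR, hbad⟩
      · have := (Finset.mem_filter.1 hiK).2
        simp [h0] at this
      · exact (hsplit i _ R (won_sub p i) hR).resolve_left hbad
    · simp only [if_neg hiK]
      exact hB i (Finset.mem_sdiff.2 ⟨hi, hiK⟩)
  · intro i hi e he hU hne
    beta_reduce at he ⊢
    by_cases hiK : i ∈ K
    · rw [if_pos hiK] at he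
      obtain ⟨h1, h2⟩ := hlost hiK he
      rwa [if_pos h1]
    · rw [if_neg hiK] at he
      by_cases hcK : c e i ∈ K
      · rw [if_pos hcK]
        intro hmem
        have := (hlost hcK hmem).1
        rw [hc e i] at this
        exact hiK this
      · rw [if_neg hcK]
        exact hBdisj i (Finset.mem_sdiff.2 ⟨hi, hiK⟩) e he (Finset.mem_sdiff.2 ⟨hU, hcK⟩) hne

/-- A subadditive agent keeps half its value, up to half an item, on one side of each partition
into two parts and at most one discarded item. -/
lemma IsValuation.half_or_half {α : Type*} [DecidableEq α] {M A S R : Finset α}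
    {v : Finset α → ℝ} (hv : IsValuation M v) (hA : A ⊆ M) {δ : ℝ} (hδ : 0 ≤ δ)
    (hvδ : ∀ e ∈ A, v {e} ≤ δ) (hS : S ⊆ A) (hR : #R ≤ 1) :
    v A ≤ 2 * v (S \ R) + δ ∨ v A ≤ 2 * v (A \ S) + δ := by
  obtain ⟨h0, hmono, hsub⟩ := hv
  have hSR : v (S ∩ R) ≤ δ := by
    have hcard : #(S ∩ R) ≤ 1 := (Finset.card_le_card Finset.inter_subset_right).trans hR
    rcases (S ∩ R).eq_empty_or_nonempty with h | ⟨e, he⟩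
    · rwa [h, h0]
    · rw [Finset.eq_singleton_iff_unique_mem.2
        ⟨he, fun x hx => Finset.card_le_one.1 hcard x hx e he⟩]
      exact hvδ e (hS (Finset.mem_inter.1 he).1)
  have h1 := hsub (S \ R) (S ∩ R) (Finset.sdiff_subset.trans (hS.trans hA))
    (Finset.inter_subset_left.trans (hS.trans hA))
  rw [Finset.sdiff_union_inter] at h1
  have h2 := hsub S (A \ S) (hS.trans hA) (Finset.sdiff_subset.trans hA)
  rw [Finset.union_sdiff_of_subset hS] at h2
  by_contra! h
  linarith [h.1, h.2]

/-- Repeated halving, with the multiplicity bounds `2 ^ k i` at most `2 ^ N`. -/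
lemma exists_disjoint_of_multi {α ι : Type*} [DecidableEq α] [LinearOrder ι] [Fintype ι]
    (M : Finset α) (v : ι → Finset α → ℝ) (hv : ∀ i, IsValuation M (v i)) (δ : ι → ℝ)
    (hδ : ∀ i, 0 ≤ δ i) (N : ℕ) (k : ι → ℕ) (hk : ∀ i, k i ≤ N) (A : ι → Finset α)
    (hAM : ∀ i, A i ⊆ M) (hvδ : ∀ i, ∀ e ∈ A i, v i {e} ≤ δ i)
    (hmulti : ∀ i, ∀ e ∈ A i, #{j | e ∈ A j} ≤ 2 ^ k i) :
    ∃ A' : ι → Finset α, (∀ i, A' i ⊆ A i) ∧ (∀ i j, i ≠ j → Disjoint (A' i) (A' j)) ∧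
      ∀ i, v i (A i) ≤ 2 ^ k i * v i (A' i) + (2 ^ k i - 1) * δ i := by
  induction N generalizing k A with
  | zero =>
    have hk0 (i) : k i = 0 := Nat.le_zero.1 (hk i)
    refine ⟨A, fun _ => le_rfl, fun i j hij => Finset.disjoint_left.2 fun e hi hj => hij ?_, ?_⟩
    · have := hmulti i e hi
      rw [hk0, pow_zero] at this
      exact Finset.card_le_one.1 this i (by simpa using hi) j (by simpa using hj)
    · intro i
      simp [hk0]
  | succ N ih =>
    let U : Finset ι := {i | k i = N + 1}
    choose c hc _ hcard using fun e : α => exists_pairing (U.filter fun j => e ∈ A j)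
    obtain ⟨B, hB, hBdisj⟩ := exists_acceptable_of_pairing M A hAM c hc
      (fun i S => v i (A i) ≤ 2 * v i S + δ i)
      (fun i S T hST hT h => by
        have := (hv i).2.1 S T hST (hT.trans (hAM i))
        linarith)
      (fun i S R hS hR => (hv i).half_or_half (hAM i) (hδ i) (hvδ i) hS hR) U
    let B' (i : ι) : Finset α := if i ∈ U then B i else A i
    have hB'A (i) : B' i ⊆ A i := by
      by_cases hi : i ∈ U
      · simpa [B', hi] using (hB i hi).1
      · simp [B', hi]
    have hle (i) (hi : i ∉ U) : k i ≤ N := by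
      have h1 := hk i
      have h2 : k i ≠ N + 1 := fun h => hi (by simp [U, h])
      omega
    have hcount (e) : #{j | e ∈ B' j} ≤ #{j | e ∈ A j} :=
      Finset.card_le_card (Finset.monotone_filter_right _ fun j _ h => hB'A j h)
    obtain ⟨A', hA', hdisj, hval⟩ := ih (fun i => min (k i) N) (fun i => min_le_right _ _) B'
      (fun i => (hB'A i).trans (hAM i)) (fun i e he => hvδ i e (hB'A i he)) (by
        intro i e he
        by_cases hsmall : ∃ j, e ∈ B' j ∧ j ∉ U
        · obtain ⟨j, hj, hjU⟩ := hsmall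
          have h1 := (hcount e).trans (hmulti j e (hB'A j hj))
          have h2 := (hcount e).trans (hmulti i e (hB'A i he))
          rcases min_choice (k i) N with h | h
          · rwa [h]
          · rw [h]
            exact h1.trans (Nat.pow_le_pow_right (by norm_num) (hle j hjU))
        · push Not at hsmall
          have hiU := hsmall i he
          have hki : k i = N + 1 := by simpa [U] using hiU
          have h1 := hcard e {j | e ∈ B' j}
            (fun j hj => by
              have hj' : e ∈ B' j := by simpa using hj
              exact Finset.mem_filter.2 ⟨hsmall j hj', hB'A j hj'⟩)
            (fun j hj hne hmem => by
              have hj' : e ∈ B' j := by simpa using hj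
              have hm' : e ∈ B' (c e j) := by simpa using hmem
              have hjU := hsmall j hj'
              have hmU := hsmall _ hm'
              simp only [B', if_pos hjU] at hj'
              simp only [B', if_pos hmU] at hm'
              exact hBdisj j hjU e hj' hmU hne hm')
          have h2 : #(U.filter fun j => e ∈ A j) ≤ 2 ^ (N + 1) :=
            (Finset.card_le_card (Finset.filter_subset_filter _ (Finset.subset_univ U))).trans
              (hki ▸ hmulti i e (hB'A i he))
          rw [hki, min_eq_right (Nat.le_succ N)]
          rw [pow_succ] at h2
          omega)
    refine ⟨A', fun i => (hA' i).trans (hB'A i), hdisj, fun i => ?_⟩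
    have h1 := hval i
    by_cases hi : i ∈ U
    · have hki : k i = N + 1 := by simpa [U] using hi
      have h2 := (hB i hi).2
      simp only [B', if_pos hi, hki, min_eq_right (Nat.le_succ N)] at h1
      rw [hki, pow_succ]
      linarith
    · simpa only [B', if_neg hi, min_eq_left (hle i hi)] using h1

theorem stmt14 {α : Type*} [DecidableEq α] (n : ℕ) (d : Fin n → ℕ)
    (hpow : ∀ i, ∃ k : ℕ, d i = 2 ^ k)
    (M : Finset α) (A : Fin n → Finset α) (hAM : ∀ i, A i ⊆ M)
    (hmulti : ∀ i, ∀ e ∈ A i, (Finset.univ.filter fun j => e ∈ A j).card ≤ d i)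
    (v : Fin n → Finset α → ℝ) (hv : ∀ i, IsValuation M (v i)) :
    ∃ A' : Fin n → Finset α,
      (∀ i, A' i ⊆ A i) ∧
      (∀ i j, i ≠ j → Disjoint (A' i) (A' j)) ∧
      ∀ i, v i (A' i) ≥
        v i (A i) / (d i) - (((d i : ℝ) - 1) / (d i)) * maxSingle (v i) (A i) := by
  choose k hk using hpow
  have hle (i) : ∀ e ∈ A i, v i {e} ≤ maxSingle (v i) (A i) := by
    intro e he
    rw [maxSingle, dif_pos ⟨e, he⟩]
    exact Finset.le_sup' (fun e => v i {e}) he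
  have hnonneg (i) : 0 ≤ maxSingle (v i) (A i) := by
    rcases (A i).eq_empty_or_nonempty with h | ⟨e, he⟩
    · simp [maxSingle, h]
    · refine le_trans ?_ (hle i e he)
      rw [← (hv i).1]
      exact (hv i).2.1 _ _ (Finset.empty_subset _) (Finset.singleton_subset_iff.2 (hAM i he))
  obtain ⟨A', hsub, hdisj, hval⟩ := exists_disjoint_of_multi M v hv
    (fun i => maxSingle (v i) (A i)) hnonneg (Finset.univ.sup k) k
    (fun i => Finset.le_sup (Finset.mem_univ i)) A hAM hle
    (fun i e he => hk i ▸ hmulti i e he)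
  refine ⟨A', hsub, hdisj, fun i => ?_⟩
  have hpos : (0 : ℝ) < d i := by
    rw [hk i]
    positivity
  have h := hval i
  rw [show (2 : ℝ) ^ k i = d i by rw [hk i]; norm_cast] at h
  rw [ge_iff_le, div_mul_eq_mul_div, ← sub_div, div_le_iff₀ hpos]
  linarith
end

section
/- In every multi-graph allocation instance on n agents with a finite item set M in which every agent i has a normalized, monotone, subadditive valuation v_i on M satisfying v_i(S) = v_i(S ∩ M^i) for all S ⊆ M, and every agent i has an entitlement b_i with 0 < b_i ≤ 1 and b_1 + ⋯ + b_n = 1, there exists an orientation allocation in which every agent i receives a bundle A_i with v_i(A_i) ≥ (1/2)·APS(M, v_i, 1/k_i), where k_i = ⌊1/b_i⌋ (so that 1/(k_i+1) < b_i ≤ 1/k_i). -/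
open Finset

/-- The anyprice share `APS(M, v, b)`: the supremum, over all fractional `b`-partitions
`(P_1, …, P_k; λ_1, …, λ_k)` of `M`, of `min_{j : λ_j > 0} v (P j)`. -/
noncomputable def APS {α : Type*} [DecidableEq α] (M : Finset α) (v : Finset α → ℝ)
    (b : ℝ) : ℝ :=
  sSup {x : ℝ | ∃ (k : ℕ) (P : Fin k → Finset α) (lam : Fin k → ℝ),
    (∀ j, P j ⊆ M) ∧ (∀ j, 0 ≤ lam j) ∧ (∑ j, lam j = 1) ∧
    (∀ e ∈ M, ∑ j ∈ Finset.univ.filter (fun j => e ∈ P j), lam j = b) ∧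
    x = sInf {y : ℝ | ∃ j, 0 < lam j ∧ y = v (P j)}}

/-- A family `W` of bundles is `K`-resilient on `N` if, whenever `N` is covered by two bundles
and fewer than `K` further items, one of the two bundles belongs to `W`. -/
def Resilient {α : Type*} [DecidableEq α] (K : ℕ) (N : Finset α) (W : Finset α → Prop) : Prop :=
  ∀ X Y F : Finset α, F.card < K → N ⊆ X ∪ Y ∪ F → W X ∨ W Y

/-- The bundles `B` such that `D`, up to at most one item, is covered by two sets each of which
can be withheld from `B ∪ D` without leaving `W`. -/
def Reduced {α : Type*} [DecidableEq α] (D : Finset α) (W : Finset α → Prop)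
    (B : Finset α) : Prop :=
  ∃ S T G : Finset α, G.card ≤ 1 ∧ D ⊆ S ∪ T ∪ G ∧ W (B ∪ D \ S) ∧ W (B ∪ D \ T)

lemma exists_subset_forall_insert_not {α : Type*} [DecidableEq α] (D : Finset α)
    (p : Finset α → Prop) (h : p ∅) :
    ∃ U ⊆ D, p U ∧ ∀ e ∈ D \ U, ¬ p (insert e U) := by
  classical
  obtain ⟨U, hU⟩ := (D.powerset.filter p).exists_maximal ⟨∅, by simp [h]⟩
  have hm := hU.prop
  simp only [mem_filter, mem_powerset] at hm
  refine ⟨U, hm.1, hm.2, fun e he hp => ?_⟩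
  rw [mem_sdiff] at he
  have hins : insert e U ∈ D.powerset.filter p := by
    simp only [mem_filter, mem_powerset]
    exact ⟨insert_subset he.1 hm.1, hp⟩
  exact he.2 (hU.le_of_ge hins (subset_insert e U) (mem_insert_self e U))

lemma Resilient.reduced {α : Type*} [DecidableEq α] {K : ℕ} {N N' : Finset α}
    {W : Finset α → Prop} (h : Resilient K N W) :
    Resilient K (N \ N') (Reduced (N ∩ N') W) := by
  intro X Y F hF hcov
  set D := N ∩ N' with hD
  have hsplit : ∀ U V : Finset α, D ⊆ U ∪ V → W (X ∪ U) ∨ W (Y ∪ V) := by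
    intro U V hUV
    refine h _ _ F hF fun e he => ?_
    by_cases hN : e ∈ N'
    · have := hUV (mem_inter.2 ⟨he, hN⟩)
      simp only [mem_union] at this ⊢
      tauto
    · have := hcov (mem_sdiff.2 ⟨he, hN⟩)
      simp only [mem_union] at this ⊢
      tauto
  by_cases h0 : W (X ∪ D \ ∅)
  · obtain ⟨U, hUD, hU, hmax⟩ := exists_subset_forall_insert_not D (fun U => W (X ∪ D \ U)) h0
    by_cases hDU : D ⊆ U
    · exact Or.inl ⟨U, U, ∅, by simp, by simpa using hDU, hU, hU⟩
    · obtain ⟨e, heD, heU⟩ := not_subset.1 hDU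
      have he := hmax e (mem_sdiff.2 ⟨heD, heU⟩)
      by_cases hX : W (X ∪ D \ (D \ insert e U))
      · refine Or.inl ⟨U, D \ insert e U, {e}, by simp, fun x hx => ?_, hU, hX⟩
        simp only [mem_union, mem_sdiff, mem_insert, mem_singleton]
        tauto
      · refine Or.inr ⟨insert e U, D \ insert e U, ∅, by simp, fun x hx => ?_, ?_, ?_⟩
        · simp only [mem_union, mem_sdiff]
          tauto
        · refine (hsplit _ _ fun x hx => ?_).resolve_left hX
          simp only [mem_union, mem_sdiff]
          tauto
        · refine (hsplit _ _ fun x hx => ?_).resolve_left he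
          simp only [mem_union, mem_sdiff]
          tauto
  · have hY : W (Y ∪ D \ D) := (hsplit (D \ ∅) (D \ D) (by simp)).resolve_left h0
    exact Or.inr ⟨D, D, ∅, by simp, by simp, hY, hY⟩

/-- If every item lies in at most two of the sets `N i`, every `W i` is `K i`-resilient on `N i`,
and every nonempty set of agents has a member whose `K i` is at least its size, then disjoint
bundles `B i ⊆ N i` with `W i (B i)` exist. -/
lemma exists_disjoint_bundles {α ι : Type*} [DecidableEq α] [DecidableEq ι] (K : ι → ℕ)
    (A : Finset ι) :
    ∀ (N : ι → Finset α) (W : ι → Finset α → Prop),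
    (∀ A' ⊆ A, A'.Nonempty → ∃ i ∈ A', A'.card ≤ K i) →
    (∀ i j k e, i ≠ j → i ≠ k → j ≠ k → e ∈ N i → e ∈ N j → e ∉ N k) →
    (∀ i, Resilient (K i) (N i) (W i)) →
    ∃ B : ι → Finset α, (∀ i, B i ⊆ N i) ∧
      (∀ i ∈ A, ∀ j ∈ A, i ≠ j → Disjoint (B i) (B j)) ∧ ∀ i ∈ A, W i (B i) := by
  induction hm : A.card generalizing A with
  | zero =>
    intro N W _ _ _
    rw [card_eq_zero] at hm
    exact ⟨fun _ => ∅, by simp, by simp [hm], by simp [hm]⟩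
  | succ m ih =>
    intro N W hK hN hW
    obtain ⟨a, haA, haK⟩ := hK A Subset.rfl (card_pos.1 (by omega))
    have hcard : (A.erase a).card = m := by rw [card_erase_of_mem haA]; omega
    obtain ⟨B, hBN, hBd, hBW⟩ := ih (A.erase a) hcard (fun i => N i \ N a)
      (fun i => Reduced (N i ∩ N a) (W i))
      (fun A' hA' => hK A' (hA'.trans (erase_subset a A)))
      (fun i j k e hij hik hjk hi hj hk => hN i j k e hij hik hjk
        (mem_sdiff.1 hi).1 (mem_sdiff.1 hj).1 (mem_sdiff.1 hk).1)
      (fun i => (hW i).reduced)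
    have hex : ∀ i, ∃ S T G : Finset α, i ∈ A.erase a → G.card ≤ 1 ∧ N i ∩ N a ⊆ S ∪ T ∪ G ∧
        W i (B i ∪ (N i ∩ N a) \ S) ∧ W i (B i ∪ (N i ∩ N a) \ T) := by
      intro i
      by_cases hi : i ∈ A.erase a
      · obtain ⟨S, T, G, h⟩ := hBW i hi
        exact ⟨S, T, G, fun _ => h⟩
      · exact ⟨∅, ∅, ∅, fun h => absurd h hi⟩
    choose S T G hSTG using hex
    have finish : ∀ R : ι → Finset α,
        W a (N a \ (A.erase a).biUnion fun i => (N i ∩ N a) \ R i) →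
        (∀ i ∈ A.erase a, W i (B i ∪ (N i ∩ N a) \ R i)) →
        ∃ B : ι → Finset α, (∀ i, B i ⊆ N i) ∧
          (∀ i ∈ A, ∀ j ∈ A, i ≠ j → Disjoint (B i) (B j)) ∧ ∀ i ∈ A, W i (B i) := by
      intro R ha hR
      refine ⟨fun i => if i = a then N a \ (A.erase a).biUnion fun i => (N i ∩ N a) \ R i
        else B i ∪ (N i ∩ N a) \ R i, fun i => ?_, fun i hi j hj hij => ?_, fun i hi => ?_⟩
      · by_cases h : i = a
        · subst h
          simp
        · simp only [h, if_false]
          exact union_subset ((hBN i).trans sdiff_subset) (sdiff_subset.trans inter_subset_left)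
      · have key : ∀ k ∈ A, k ≠ a →
            Disjoint (N a \ (A.erase a).biUnion fun i => (N i ∩ N a) \ R i)
              (B k ∪ (N k ∩ N a) \ R k) := by
          intro k hk hka
          rw [disjoint_left]
          intro e he he'
          rw [mem_sdiff] at he
          rcases mem_union.1 he' with h | h
          · exact (mem_sdiff.1 (hBN k h)).2 he.1
          · exact he.2 (mem_biUnion.2 ⟨k, mem_erase.2 ⟨hka, hk⟩, h⟩)
        by_cases h : i = a
        · have hja : j ≠ a := fun h' => hij (h.trans h'.symm)
          simp only [h, hja, if_true, if_false]
          exact key j hj hja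
        · by_cases hja : j = a
          · simp only [h, hja, if_true, if_false]
            exact (key i hi h).symm
          · simp only [h, hja, if_false]
            rw [disjoint_left]
            intro e he he'
            rcases mem_union.1 he with h1 | h1 <;> rcases mem_union.1 he' with h2 | h2
            · exact disjoint_left.1
                (hBd i (mem_erase.2 ⟨h, hi⟩) j (mem_erase.2 ⟨hja, hj⟩) hij) h1 h2
            · exact (mem_sdiff.1 (hBN i h1)).2 (mem_inter.1 (mem_sdiff.1 h2).1).2
            · exact (mem_sdiff.1 (hBN j h2)).2 (mem_inter.1 (mem_sdiff.1 h1).1).2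
            · have h1 := mem_inter.1 (mem_sdiff.1 h1).1
              have h2 := mem_inter.1 (mem_sdiff.1 h2).1
              exact hN i j a e hij h hja h1.1 h2.1 h1.2
      · by_cases h : i = a
        · subst h
          simpa using ha
        · simp only [h, if_false]
          exact hR i (mem_erase.2 ⟨h, hi⟩)
    have hF : ((A.erase a).biUnion G).card < K a := by
      have := card_biUnion_le_card_mul (A.erase a) G 1 fun i hi => (hSTG i hi).1
      omega
    have hcov : N a ⊆ (N a \ (A.erase a).biUnion fun i => (N i ∩ N a) \ S i) ∪
        (N a \ (A.erase a).biUnion fun i => (N i ∩ N a) \ T i) ∪ (A.erase a).biUnion G := by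
      intro e he
      by_contra hcon
      simp only [mem_union, not_or] at hcon
      obtain ⟨⟨hS, hT⟩, hG⟩ := hcon
      simp only [mem_sdiff, he, true_and, not_not, mem_biUnion, mem_inter, and_true] at hS hT
      obtain ⟨i, hi, hiN, hiS⟩ := hS
      obtain ⟨j, hj, hjN, hjT⟩ := hT
      have hij : i = j := by
        by_contra hij
        exact hN i j a e hij (ne_of_mem_erase hi) (ne_of_mem_erase hj) hiN hjN he
      subst hij
      have := (hSTG i hi).2.1 (mem_inter.2 ⟨hiN, he⟩)
      simp only [mem_union] at this
      have := fun h => hG (mem_biUnion.2 ⟨i, hi, h⟩)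
      tauto
    rcases hW a _ _ _ hF hcov with h | h
    · exact finish S h fun i hi => (hSTG i hi).2.2.1
    · exact finish T h fun i hi => (hSTG i hi).2.2.2

/-- In a fractional `1 / K`-partition, some bundle of positive weight avoids any given set of
fewer than `K` items. -/
lemma exists_pos_weight_disjoint {α : Type*} [DecidableEq α] {M F : Finset α} {K k : ℕ}
    {P : Fin k → Finset α} {lam : Fin k → ℝ} (hP : ∀ j, P j ⊆ M) (hlam : ∀ j, 0 ≤ lam j)
    (hsum : ∑ j, lam j = 1)
    (hcov : ∀ e ∈ M, ∑ j ∈ univ.filter (fun j => e ∈ P j), lam j = 1 / (K : ℝ))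
    (hF : F.card < K) : ∃ j, 0 < lam j ∧ Disjoint (P j) F := by
  by_contra! hcon
  have hK : (0 : ℝ) < K := by exact_mod_cast (Nat.zero_le _).trans_lt hF
  have hle : ∑ j, lam j ≤ ∑ j, ∑ e ∈ F ∩ M, if e ∈ P j then lam j else 0 := by
    refine sum_le_sum fun j _ => ?_
    have hnn : ∀ e ∈ F ∩ M, 0 ≤ if e ∈ P j then lam j else 0 := fun e _ => by
      split_ifs
      exacts [hlam j, le_rfl]
    rcases (hlam j).eq_or_lt with h | h
    · rw [← h] at hnn ⊢
      exact sum_nonneg hnn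
    · obtain ⟨e, heP, heF⟩ := not_disjoint_iff.1 (hcon j h)
      have := single_le_sum hnn (mem_inter.2 ⟨heF, hP j heP⟩)
      simpa [heP] using this
  rw [sum_comm, hsum] at hle
  have heq : ∑ e ∈ F ∩ M, ∑ j, (if e ∈ P j then lam j else 0) = (F ∩ M).card * (1 / (K : ℝ)) := by
    rw [← nsmul_eq_mul]
    refine sum_eq_card_nsmul fun e he => ?_
    rw [← sum_filter]
    exact hcov e (mem_inter.1 he).2
  rw [heq, mul_one_div, le_div_iff₀ hK, one_mul] at hle
  have hle : K ≤ (F ∩ M).card := by exact_mod_cast hle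
  have := card_le_card (inter_subset_left (s₁ := F) (s₂ := M))
  omega

/-- The bundles worth at least half of the anyprice share at `1 / K` are `K`-resilient on any set
of items that determines the valuation. -/
lemma resilient_half_APS {α : Type*} [DecidableEq α] {M N : Finset α} {v : Finset α → ℝ}
    (hv : IsValuation M v) (hN : ∀ S ⊆ M, v S = v (S ∩ N)) (K : ℕ) :
    Resilient K N fun S => 1 / 2 * APS M v (1 / (K : ℝ)) ≤ v (S ∩ M) := by
  obtain ⟨hv0, hmono, hsub⟩ := hv
  have hnonneg : ∀ S ⊆ M, 0 ≤ v S := fun S hS => hv0 ▸ hmono ∅ S (empty_subset S) hS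
  intro X Y F hF hcov
  by_contra! hcon
  have hX := hnonneg (X ∩ M) inter_subset_right
  have hY := hnonneg (Y ∩ M) inter_subset_right
  have hlt : v (X ∩ M) + v (Y ∩ M) < APS M v (1 / (K : ℝ)) := by linarith [hcon.1, hcon.2]
  unfold APS at hlt
  obtain ⟨x, ⟨k, P, lam, hP, hlam, hsum, hcovP, rfl⟩, hx⟩ := exists_lt_of_lt_csSup
    (Set.nonempty_iff_ne_empty.2 fun h => by
      rw [h, Real.sSup_empty] at hlt
      linarith) hlt
  obtain ⟨j, hj, hdisj⟩ := exists_pos_weight_disjoint hP hlam hsum hcovP hF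
  have hinf : sInf {y : ℝ | ∃ j, 0 < lam j ∧ y = v (P j)} ≤ v (P j) :=
    csInf_le ⟨0, by rintro y ⟨i, -, rfl⟩; exact hnonneg _ (hP i)⟩ ⟨j, hj, rfl⟩
  have hPN : P j ∩ N ⊆ X ∩ M ∪ Y ∩ M := by
    intro e he
    have heP := (mem_inter.1 he).1
    have hXY := hcov (mem_inter.1 he).2
    have heF := disjoint_left.1 hdisj heP
    have heM := hP j heP
    simp only [mem_union, mem_inter] at hXY ⊢
    tauto
  have h1 := hmono _ _ hPN (union_subset inter_subset_right inter_subset_right)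
  have h2 := hsub (X ∩ M) (Y ∩ M) inter_subset_right inter_subset_right
  linarith [hN (P j) (hP j)]

/-- Among any nonempty set of agents whose entitlements add up to at most `1`, some agent `i`
has `⌊1 / b i⌋₊` at least the number of these agents. -/
lemma exists_card_le_floor_inv {ι : Type*} {b : ι → ℝ} (hb : ∀ i, 0 < b i) {A : Finset ι}
    (hA : A.Nonempty) (hsum : ∑ i ∈ A, b i ≤ 1) : ∃ i ∈ A, A.card ≤ ⌊1 / b i⌋₊ := by
  by_contra! hcon
  have hpos : (0 : ℝ) < A.card := by exact_mod_cast hA.card_pos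
  have hlt : ∑ _i ∈ A, 1 / (A.card : ℝ) < ∑ i ∈ A, b i := by
    refine sum_lt_sum_of_nonempty hA fun i hi => ?_
    have h1 := Nat.lt_floor_add_one (1 / b i)
    have h2 : (⌊1 / b i⌋₊ : ℝ) + 1 ≤ A.card := by exact_mod_cast hcon i hi
    exact (one_div_lt hpos (hb i)).2 (h1.trans_le h2)
  rw [sum_const, nsmul_eq_mul, mul_one_div, div_self hpos.ne'] at hlt
  linarith

theorem stmt16 {α : Type*} [DecidableEq α] (n : ℕ)
    (M : Finset α) (E : α → Finset (Fin n)) (hE : ∀ e ∈ M, (E e).card ≤ 2)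
    (v : Fin n → Finset α → ℝ) (hv : ∀ i, IsValuation M (v i))
    (hloc : ∀ i, ∀ S ⊆ M, v i S = v i (S.filter fun e => i ∈ E e))
    (b : Fin n → ℝ) (hb : ∀ i, 0 < b i) (hb1 : ∀ i, b i ≤ 1) (hbsum : ∑ i, b i = 1) :
    ∃ f : α → Fin n,
      (∀ e ∈ M, (E e).Nonempty → f e ∈ E e) ∧
      ∀ i, v i (M.filter fun e => f e = i) ≥ (1 / 2) * APS M (v i) (1 / (⌊1 / b i⌋₊ : ℝ)) := by
  have hn : Nonempty (Fin n) := by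
    rcases n with _ | n
    · simp at hbsum
    · exact ⟨0⟩
  obtain ⟨B, hBN, hBd, hBW⟩ := exists_disjoint_bundles (fun i => ⌊1 / b i⌋₊) univ
    (fun i => M.filter fun e => i ∈ E e)
    (fun i S => 1 / 2 * APS M (v i) (1 / (⌊1 / b i⌋₊ : ℝ)) ≤ v i (S ∩ M))
    (fun A hA hne => exists_card_le_floor_inv hb hne
      (hbsum ▸ sum_le_sum_of_subset_of_nonneg hA fun i _ _ => (hb i).le))
    (fun i j k e hij hik hjk hi hj hk => by
      rw [mem_filter] at hi hj hk
      have hsub : ({i, j, k} : Finset (Fin n)) ⊆ E e := by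
        simp [insert_subset_iff, hi.2, hj.2, hk.2]
      have := (card_le_card hsub).trans (hE e hi.1)
      rw [card_eq_three.2 ⟨i, j, k, hij, hik, hjk, rfl⟩] at this
      omega)
    (fun i => resilient_half_APS (hv i) (fun S hS => by
      rw [hloc i S hS]
      congr 1
      ext e
      simp only [mem_filter, mem_inter]
      have := @hS e
      tauto) _)
  have hf : ∀ e, ∃ i, (e ∈ M → (E e).Nonempty → i ∈ E e) ∧ ∀ j, e ∈ B j → i = j := by
    intro e
    by_cases h : ∃ j, e ∈ B j
    · obtain ⟨j, hj⟩ := h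
      refine ⟨j, fun _ _ => (mem_filter.1 (hBN j hj)).2, fun i hi => ?_⟩
      by_contra hij
      exact disjoint_left.1 (hBd j (mem_univ j) i (mem_univ i) hij) hj hi
    · by_cases hne : (E e).Nonempty
      · exact ⟨hne.choose, fun _ _ => hne.choose_spec, fun j hj => absurd ⟨j, hj⟩ h⟩
      · exact ⟨hn.some, fun _ h' => absurd h' hne, fun j hj => absurd ⟨j, hj⟩ h⟩
  choose f hfE hfB using hf
  refine ⟨f, hfE, fun i => (hBW i (mem_univ i)).trans ?_⟩
  refine (hv i).2.1 _ _ (fun e he => ?_) (filter_subset _ _)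
  rw [mem_inter] at he
  exact mem_filter.2 ⟨he.2, hfB e i he.1⟩
end

section
/- Let M = {e_1, e_2, e_3, e_4} and let v be the valuation on M defined by v(T) = max(|T ∩ {e_1, e_2}|, |T ∩ {e_3, e_4}|); v is normalized, monotone, and subadditive. For the four-round picking sequences S_1 = (q, p, p, q) and S_2 = (p, q, p, q), the maximin value of player p satisfies ω(S_2, M, v) = 1 and ω(S_1, M, v) = 2; in particular, even though every prefix of S_2 contains at least as many picks by p as the corresponding prefix of S_1, it holds that ω(S_2, M, v) < ω(S_1, M, v). -/
open Finset

/-- The value, for player `p`, of the picking game with picking sequence `s` (`true` means it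
is `p`'s turn to pick, `false` means it is `q`'s turn), `v` the valuation of `p`, `R` the
remaining items, and `T` the set of items already picked by `p`. -/
noncomputable def pickSeqVal {α : Type*} [DecidableEq α] (v : Finset α → ℝ) :
    List Bool → Finset α → Finset α → ℝ
  | [], _, T => v T
  | b :: s, R, T =>
    if hR : R.Nonempty then
      if b then
        (R.image fun e => pickSeqVal v s (R.erase e) (insert e T)).max' (hR.image _)
      else
        (R.image fun e => pickSeqVal v s (R.erase e) T).min' (hR.image _)
    else v T

section

variable {α : Type*} [DecidableEq α] {v : Finset α → ℝ} {s : List Bool} {R T : Finset α} {c : ℝ}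

theorem pickSeqVal_nil : pickSeqVal v [] R T = v T := by
  rw [pickSeqVal]

theorem le_pickSeqVal_true_cons_iff (hR : R.Nonempty) :
    c ≤ pickSeqVal v (true :: s) R T ↔
      ∃ e ∈ R, c ≤ pickSeqVal v s (R.erase e) (insert e T) := by
  rw [← not_iff_not]
  simp [pickSeqVal, hR, Finset.max'_lt_iff]

theorem pickSeqVal_true_cons_le_iff (hR : R.Nonempty) :
    pickSeqVal v (true :: s) R T ≤ c ↔
      ∀ e ∈ R, pickSeqVal v s (R.erase e) (insert e T) ≤ c := by
  simp [pickSeqVal, hR, Finset.max'_le_iff]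

theorem le_pickSeqVal_false_cons_iff (hR : R.Nonempty) :
    c ≤ pickSeqVal v (false :: s) R T ↔ ∀ e ∈ R, c ≤ pickSeqVal v s (R.erase e) T := by
  simp [pickSeqVal, hR, Finset.le_min'_iff]

theorem pickSeqVal_false_cons_le_iff (hR : R.Nonempty) :
    pickSeqVal v (false :: s) R T ≤ c ↔ ∃ e ∈ R, pickSeqVal v s (R.erase e) T ≤ c := by
  rw [← not_iff_not]
  simp [pickSeqVal, hR, Finset.lt_min'_iff]

end

theorem univ_fin_four_erase_nonempty (a : Fin 4) : (Finset.univ.erase a).Nonempty := by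
  revert a; decide

theorem univ_fin_four_erase_erase_nonempty (a b : Fin 4) :
    ((Finset.univ.erase a).erase b).Nonempty := by
  revert a b; decide

theorem univ_fin_four_erase_erase_erase_nonempty (a b c : Fin 4) :
    (((Finset.univ.erase a).erase b).erase c).Nonempty := by
  revert a b c; decide

theorem stmt17 :
    let v : Finset (Fin 4) → ℝ :=
      fun T => ((max (T ∩ ({0, 1} : Finset (Fin 4))).card
        (T ∩ ({2, 3} : Finset (Fin 4))).card : ℕ) : ℝ)
    let S1 : List Bool := [false, true, true, false]
    let S2 : List Bool := [true, false, true, false]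
    v ∅ = 0 ∧
    (∀ S T : Finset (Fin 4), S ⊆ T → v S ≤ v T) ∧
    (∀ S T : Finset (Fin 4), v (S ∪ T) ≤ v S + v T) ∧
    (∀ t : ℕ, ((S1.take t).count true) ≤ ((S2.take t).count true)) ∧
    pickSeqVal v S2 Finset.univ ∅ = 1 ∧
    pickSeqVal v S1 Finset.univ ∅ = 2 ∧
    pickSeqVal v S2 Finset.univ ∅ < pickSeqVal v S1 Finset.univ ∅ := by
  intro v S1 S2
  have h2 : pickSeqVal v S2 Finset.univ ∅ = 1 := by
    apply le_antisymm
    · simp only [S2, pickSeqVal_true_cons_le_iff, pickSeqVal_false_cons_le_iff,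
        Finset.univ_nonempty, univ_fin_four_erase_nonempty, univ_fin_four_erase_erase_nonempty,
        univ_fin_four_erase_erase_erase_nonempty, pickSeqVal_nil, v, Nat.cast_le_one]
      decide
    · simp only [S2, le_pickSeqVal_true_cons_iff, le_pickSeqVal_false_cons_iff,
        Finset.univ_nonempty, univ_fin_four_erase_nonempty, univ_fin_four_erase_erase_nonempty,
        univ_fin_four_erase_erase_erase_nonempty, pickSeqVal_nil, v, Nat.one_le_cast]
      decide
  have h1 : pickSeqVal v S1 Finset.univ ∅ = 2 := by
    apply le_antisymm
    · simp only [S1, pickSeqVal_true_cons_le_iff, pickSeqVal_false_cons_le_iff,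
        Finset.univ_nonempty, univ_fin_four_erase_nonempty, univ_fin_four_erase_erase_nonempty,
        univ_fin_four_erase_erase_erase_nonempty, pickSeqVal_nil, v, Nat.cast_le_ofNat]
      decide
    · simp only [S1, le_pickSeqVal_true_cons_iff, le_pickSeqVal_false_cons_iff,
        Finset.univ_nonempty, univ_fin_four_erase_nonempty, univ_fin_four_erase_erase_nonempty,
        univ_fin_four_erase_erase_erase_nonempty, pickSeqVal_nil, v, Nat.ofNat_le_cast]
      decide
  refine ⟨by simp [v], fun S T h => ?_, fun S T => ?_, fun t => ?_, h2, h1, ?_⟩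
  · simp only [v]
    gcongr
  · simp only [v, Finset.union_inter_distrib_right]
    norm_cast
    have ha := Finset.card_union_le (S ∩ {0, 1}) (T ∩ {0, 1})
    have hb := Finset.card_union_le (S ∩ {2, 3}) (T ∩ {2, 3})
    omega
  · rcases t with _ | _ | _ | t <;> simp [S1, S2]
  · rw [h1, h2]
    norm_num
end
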